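/- For all integers i ≥ 1 and j ≥ 0, the Maaß raising operator of weight j-i satisfies R_{j-i} 𝔢_{i,j} = 𝔢_{i-1,j+1}; that is, for every τ ∈ ℍ and every X ∈ ℂ, 2i ∂_τ [𝔢_{i,j}(τ, X)] + ((j-i)/y)·𝔢_{i,j}(τ, X) = 𝔢_{i-1,j+1}(τ, X), where ∂_τ = (∂_x - i∂_y)/2 is taken in the variable τ = x+iy for fixed X. -/

import Mathlib

open Complex

/-- `ee i j τ X` is `𝔢_{i,j}(τ,X) = ((-1)^j / i!) · (Im τ)^{-j} · (X-τ)^i · (X-conj τ)^j`. -/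
noncomputable def ee (i j : ℕ) (τ X : ℂ) : ℂ :=
  ((-1 : ℂ) ^ j / (Nat.factorial i : ℂ)) * (τ.im : ℂ) ^ (-(j : ℤ)) *
    (X - τ) ^ i * (X - (starRingEnd ℂ) τ) ^ j

/-- Wirtinger derivative `∂_τ = (∂_x - i ∂_y)/2`. -/
noncomputable def dz (f : ℂ → ℂ) (τ : ℂ) : ℂ :=
  (fderiv ℝ f τ 1 - Complex.I * fderiv ℝ f τ Complex.I) / 2

/-- The real Fréchet derivative of `w ↦ c · (Im w)^m · (X - w)^i · (X - conj w)^j`. -/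
theorem fderiv_const_mul_im_zpow_mul_pow_mul_pow (c X : ℂ) (m : ℤ) (i j : ℕ) {τ : ℂ}
    (hτ : τ.im ≠ 0) (v : ℂ) :
    fderiv ℝ (fun w : ℂ => c * (w.im : ℂ) ^ m * (X - w) ^ i * (X - (starRingEnd ℂ) w) ^ j) τ v =
      c * (m * (τ.im : ℂ) ^ (m - 1) * v.im) * (X - τ) ^ i * (X - (starRingEnd ℂ) τ) ^ j
      - c * (τ.im : ℂ) ^ m * (i * (X - τ) ^ (i - 1) * v) * (X - (starRingEnd ℂ) τ) ^ j
      - c * (τ.im : ℂ) ^ m * (X - τ) ^ i *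
        (j * (X - (starRingEnd ℂ) τ) ^ (j - 1) * (starRingEnd ℂ) v) := by
  have him : HasFDerivAt (fun w : ℂ => (w.im : ℂ)) (ofRealCLM.comp imCLM) τ :=
    (ofRealCLM.comp imCLM).hasFDerivAt
  have hzpow : HasFDerivAt (fun w : ℂ => (w.im : ℂ) ^ m)
      ((m * (τ.im : ℂ) ^ (m - 1)) • ofRealCLM.comp imCLM) τ :=
    (hasDerivAt_zpow m (τ.im : ℂ) (Or.inl (ofReal_ne_zero.mpr hτ))).complexToReal_fderiv.comp
      (f := fun w : ℂ => (w.im : ℂ)) τ him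
  have hsub : HasFDerivAt (fun w : ℂ => (X - w) ^ i) _ τ :=
    ((hasFDerivAt_id (𝕜 := ℝ) τ).const_sub X).pow i
  have hconj : HasFDerivAt (fun w : ℂ => (X - (starRingEnd ℂ) w) ^ j) _ τ :=
    ((conjCLE : ℂ →L[ℝ] ℂ).hasFDerivAt.const_sub X).pow j
  rw [(((hzpow.const_mul c).fun_mul hsub).fun_mul hconj).fderiv]
  simp
  ring

/-- The Maaß raising operator of weight `j-i` satisfies `R_{j-i} 𝔢_{i,j} = 𝔢_{i-1,j+1}` for
`i ≥ 1`. -/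
theorem raising_of_e (i j : ℕ) (hi : 1 ≤ i) (τ X : ℂ) (hτ : 0 < τ.im) :
    2 * Complex.I * dz (fun w => ee i j w X) τ
        + (((j : ℂ) - (i : ℂ)) / (τ.im : ℂ)) * ee i j τ X
      = ee (i - 1) (j + 1) τ X := by
  obtain ⟨n, rfl⟩ : ∃ n, i = n + 1 := ⟨i - 1, by omega⟩
  have hy : (τ.im : ℂ) ≠ 0 := ofReal_ne_zero.mpr hτ.ne'
  have hn : ((n + 1 : ℕ) : ℂ) ≠ 0 := by exact_mod_cast n.succ_ne_zero
  have hfact : (n.factorial : ℂ) ≠ 0 := by exact_mod_cast n.factorial_ne_zero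
  have hconj : (starRingEnd ℂ) τ = τ - 2 * I * τ.im := by
    linear_combination (norm := (push_cast; ring)) -sub_conj τ
  simp only [dz, ee, fderiv_const_mul_im_zpow_mul_pow_mul_pow _ _ _ _ _ hτ.ne']
  simp only [one_im, I_im, map_one, conj_I, ofReal_zero, ofReal_one, Nat.add_sub_cancel,
    Nat.factorial_succ, zpow_sub_one₀ hy, zpow_neg, zpow_natCast, pow_succ (τ.im : ℂ),
    pow_succ (-1 : ℂ), pow_succ (X - τ), pow_succ (X - (starRingEnd ℂ) τ), Nat.cast_mul,
    Int.cast_neg, Int.cast_natCast]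
  generalize (X - (starRingEnd ℂ) τ) ^ (j - 1) = P
  generalize (X - (starRingEnd ℂ) τ) ^ j = Q
  rw [hconj]
  push_cast at hn ⊢
  field_simp
  ring_nf
  simp only [I_pow_three, I_sq]
  ring
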